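/- arXiv:2404.17407 — 5 statements merged into one kernel-verified Lean document; each statement's English description precedes it below -/
import Mathlib

section
/- For every positive integer N there exists a constant c₀ > 0, depending only on N, with the following property: whenever V and W are linear subspaces of ℝ^N with dim V ≤ dim W and d_H(V, W) ≤ c₀, one has V^⊥ + W = ℝ^N (where V^⊥ denotes the orthogonal complement of V). -/
/-- For every positive integer `N` there exists `c₀ > 0`, depending only on `N`,
such that whenever `V` and `W` are linear subspaces of `ℝ^N` with `dim V ≤ dim W` and
`d_H(V, W) ≤ c₀` (Hausdorff distance between `V ∩ S^{N-1}` and `W ∩ S^{N-1}`),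
one has `V^⊥ + W = ℝ^N`. -/
theorem statement0 (N : ℕ) (hN : 0 < N) :
    ∃ c₀ : ℝ, 0 < c₀ ∧
      ∀ V W : Submodule ℝ (EuclideanSpace ℝ (Fin N)),
        Module.finrank ℝ V ≤ Module.finrank ℝ W →
        Metric.hausdorffDist
            ((V : Set (EuclideanSpace ℝ (Fin N))) ∩ Metric.sphere 0 1)
            ((W : Set (EuclideanSpace ℝ (Fin N))) ∩ Metric.sphere 0 1) ≤ c₀ →
        Vᗮ ⊔ W = ⊤ := by
  refine ⟨1, one_pos, fun V W hdim hd => ?_⟩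
  rw [← Submodule.orthogonal_eq_bot_iff, ← Submodule.inf_orthogonal,
    Submodule.orthogonal_orthogonal, Submodule.eq_bot_iff]
  rintro x ⟨hxV, hxW⟩
  by_contra hx
  set v : EuclideanSpace ℝ (Fin N) := (‖x‖⁻¹ : ℝ) • x
  have hvV : v ∈ V := V.smul_mem _ hxV
  have hvW : v ∈ Wᗮ := Wᗮ.smul_mem _ hxW
  have hv : ‖v‖ = 1 := norm_smul_inv_norm (𝕜 := ℝ) hx
  have hvS : v ∈ (V : Set (EuclideanSpace ℝ (Fin N))) ∩ Metric.sphere 0 1 :=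
    ⟨hvV, by simpa using hv⟩
  have hW : W ≠ ⊥ := by
    rintro rfl
    have hV : V = ⊥ := by
      rw [← Submodule.finrank_eq_zero (R := ℝ)]
      simpa using hdim
    exact hx (by simpa [hV] using hxV)
  obtain ⟨y, hyW, hy⟩ := W.ne_bot_iff.mp hW
  have hfin := Metric.hausdorffEDist_ne_top_of_nonempty_of_bounded
    (s := (V : Set (EuclideanSpace ℝ (Fin N))) ∩ Metric.sphere 0 1)
    (t := (W : Set (EuclideanSpace ℝ (Fin N))) ∩ Metric.sphere 0 1)
    ⟨v, hvS⟩
    ⟨(‖y‖⁻¹ : ℝ) • y, W.smul_mem _ hyW, by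
      simpa using norm_smul_inv_norm (𝕜 := ℝ) hy⟩
    (Metric.isBounded_sphere.subset Set.inter_subset_right)
    (Metric.isBounded_sphere.subset Set.inter_subset_right)
  obtain ⟨w, ⟨hwW, hw⟩, hvw⟩ := Metric.exists_dist_lt_of_hausdorffDist_lt
    hvS (hd.trans_lt (by norm_num : (1 : ℝ) < 1.2)) hfin
  have hw1 : ‖w‖ = 1 := by simpa using hw
  have horth : inner ℝ v w = 0 := Submodule.inner_left_of_mem_orthogonal hwW hvW
  have hsq := norm_sub_sq_real v w
  rw [dist_eq_norm] at hvw
  rw [horth, hv, hw1] at hsq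
  nlinarith [norm_nonneg (v - w)]
end

section
/- Let a, b, c be positive integers, β ∈ (0,1], M ≥ 0, and let ψ : ℝ^a × ℝ^b → ℝ^c be of class C² with ‖D²ψ(p) − D²ψ(q)‖ ≤ M‖p − q‖^β for all p, q ∈ ℝ^a × ℝ^b. Assume that ψ(x, 0) = 0 for every x ∈ ℝ^a and that D_zψ(x, 0) = 0 for every x ∈ ℝ^a. Then for every (x, z) ∈ ℝ^a × ℝ^b one has ‖D_xψ(x, z)‖ ≤ M‖z‖^{1+β}, where D_xψ(x, z) denotes the Fréchet derivative of the map x' ↦ ψ(x', z) at x. -/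
section PartialDerivative

variable {E F G : Type*} [NormedAddCommGroup E] [NormedSpace ℝ E] [NormedAddCommGroup F]
  [NormedSpace ℝ F] [NormedAddCommGroup G] [NormedSpace ℝ G]

theorem HasFDerivAt.comp_prodMk_left {f : E × F → G} {f' : E × F →L[ℝ] G} {x : E} {z : F}
    (hf : HasFDerivAt f f' (x, z)) :
    HasFDerivAt (fun z' => f (x, z')) (f'.comp (ContinuousLinearMap.inr ℝ E F)) z :=
  hf.comp z (hasFDerivAt_prodMk_right x z)

theorem HasFDerivAt.comp_prodMk_right {f : E × F → G} {f' : E × F →L[ℝ] G} {x : E} {z : F}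
    (hf : HasFDerivAt f f' (x, z)) :
    HasFDerivAt (fun x' => f (x', z)) (f'.comp (ContinuousLinearMap.inl ℝ E F)) x :=
  hf.comp x (hasFDerivAt_prodMk_left x z)

theorem HasFDerivAt.apply_left_eq_zero {f : E × F → G} {f' : E × F →L[ℝ] G} {x : E} {z : F}
    (hf : HasFDerivAt f f' (x, z)) (h0 : ∀ x', f (x', z) = 0) (h : E) : f' (h, 0) = 0 := by
  have h1 := hf.comp_prodMk_right
  simp only [h0] at h1
  simpa using congrArg (fun L => L h) (h1.unique (hasFDerivAt_const (0 : G) x))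

theorem fderiv_eq_zero_of_partial_eq_zero {f : E × F → G} {x : E} {z : F}
    (hf : DifferentiableAt ℝ f (x, z)) (h0 : ∀ x', f (x', z) = 0)
    (hz : fderiv ℝ (fun z' => f (x, z')) z = 0) : fderiv ℝ f (x, z) = 0 := by
  refine ContinuousLinearMap.ext fun ⟨h, k⟩ => ?_
  have hk : fderiv ℝ f (x, z) (0, k) = 0 := by
    have := hf.hasFDerivAt.comp_prodMk_left.fderiv
    rw [hz] at this
    simpa using congrArg (fun L => L k) this.symm
  have hadd : ((h, k) : E × F) = (h, 0) + (0, k) := by simp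
  rw [hadd, map_add, hk, hf.hasFDerivAt.apply_left_eq_zero h0]
  simp

theorem norm_fderiv_left_le_of_holder {β M : ℝ} (hβ : 0 < β) (hM : 0 ≤ M) {f : E × F → G}
    (hf : ContDiff ℝ 2 f)
    (hHol : ∀ p q, ‖fderiv ℝ (fderiv ℝ f) p - fderiv ℝ (fderiv ℝ f) q‖ ≤ M * ‖p - q‖ ^ β)
    (h0 : ∀ x, f (x, 0) = 0) (hz0 : ∀ x, fderiv ℝ (fun z => f (x, z)) 0 = 0) (x : E) (z : F) :
    ‖fderiv ℝ (fun x' => f (x', z)) x‖ ≤ M * ‖z‖ ^ (1 + β) := by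
  have hd : Differentiable ℝ f := hf.differentiable (by norm_num)
  have hd2 : Differentiable ℝ (fderiv ℝ f) :=
    (hf.fderiv_right (m := 1) (by norm_num)).differentiable (by norm_num)
  have hD0 : ∀ x, fderiv ℝ f (x, 0) = 0 := fun x =>
    fderiv_eq_zero_of_partial_eq_zero (hd _) h0 (hz0 x)
  have hsymm : IsSymmSndFDerivAt ℝ f (x, 0) :=
    hf.contDiffAt.isSymmSndFDerivAt (by simp)
  have hmixed : ∀ (h : E) (v : E × F), fderiv ℝ (fderiv ℝ f) (x, 0) v (h, 0) = 0 := by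
    intro h v
    rw [hsymm.eq, (hd2 (x, 0)).hasFDerivAt.apply_left_eq_zero hD0]
    simp
  let R : (E × F →L[ℝ] G) →L[ℝ] (E →L[ℝ] G) :=
    (ContinuousLinearMap.compL ℝ E (E × F) G).flip (ContinuousLinearMap.inl ℝ E F)
  have hderiv : ∀ w : F, HasFDerivAt (fun w => R (fderiv ℝ f (x, w)))
      (R.comp ((fderiv ℝ (fderiv ℝ f) (x, w)).comp (ContinuousLinearMap.inr ℝ E F))) w :=
    fun w => R.hasFDerivAt.comp w (hd2 (x, w)).hasFDerivAt.comp_prodMk_left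
  have hbound : ∀ w ∈ Metric.closedBall (0 : F) ‖z‖,
      ‖R.comp ((fderiv ℝ (fderiv ℝ f) (x, w)).comp (ContinuousLinearMap.inr ℝ E F))‖
        ≤ M * ‖z‖ ^ β := by
    intro w hw
    have hw' : ‖w‖ ≤ ‖z‖ := by simpa using hw
    refine ContinuousLinearMap.opNorm_le_bound₂ _ (by positivity) fun k h => ?_
    have heq : R.comp ((fderiv ℝ (fderiv ℝ f) (x, w)).comp (ContinuousLinearMap.inr ℝ E F)) k h
        = (fderiv ℝ (fderiv ℝ f) (x, w) - fderiv ℝ (fderiv ℝ f) (x, 0)) (0, k) (h, 0) := by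
      simp [R, hmixed]
    rw [heq]
    have hop := (fderiv ℝ (fderiv ℝ f) (x, w)
      - fderiv ℝ (fderiv ℝ f) (x, 0)).le_opNorm₂ (0, k) (h, 0)
    have hH := hHol (x, w) (x, 0)
    simp only [Prod.mk_sub_mk, sub_self, sub_zero, Prod.norm_mk, norm_zero, norm_nonneg,
      sup_of_le_right, sup_of_le_left] at hop hH
    refine hop.trans ?_
    gcongr
    exact hH.trans (by gcongr)
  have hmv := (convex_closedBall (0 : F) ‖z‖).norm_image_sub_le_of_norm_hasFDerivWithin_le
    (fun w _ => (hderiv w).hasFDerivWithinAt) hbound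
    (show (0 : F) ∈ Metric.closedBall (0 : F) ‖z‖ by simp)
    (show z ∈ Metric.closedBall (0 : F) ‖z‖ by simp)
  rw [(hd (x, z)).hasFDerivAt.comp_prodMk_right.fderiv]
  simp only [hD0, map_zero, sub_zero] at hmv
  rw [Real.rpow_one_add' (norm_nonneg z) (by positivity), mul_comm ‖z‖, ← mul_assoc]
  exact hmv

end PartialDerivative


/-- Let `ψ : ℝ^a × ℝ^b → ℝ^c` be `C²` with `β`-Hölder second derivative with
constant `M` (the second derivative being realized as `fderiv ℝ (fderiv ℝ ψ)`).  Assume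
`ψ(x, 0) = 0` and `D_zψ(x, 0) = 0` for every `x`.  Then
`‖D_xψ(x, z)‖ ≤ M ‖z‖^{1+β}` for every `(x, z)`, where `D_xψ(x, z)` is the derivative
of `x' ↦ ψ(x', z)` at `x`. -/
theorem statement7 (a b c : ℕ) (ha : 0 < a) (hb : 0 < b) (hc : 0 < c)
    (β : ℝ) (hβ : β ∈ Set.Ioc (0 : ℝ) 1) (M : ℝ) (hM : 0 ≤ M)
    (ψ : EuclideanSpace ℝ (Fin a) × EuclideanSpace ℝ (Fin b) → EuclideanSpace ℝ (Fin c))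
    (hψ : ContDiff ℝ 2 ψ)
    (hHol : ∀ p q : EuclideanSpace ℝ (Fin a) × EuclideanSpace ℝ (Fin b),
      ‖fderiv ℝ (fderiv ℝ ψ) p - fderiv ℝ (fderiv ℝ ψ) q‖ ≤ M * ‖p - q‖ ^ β)
    (hz0 : ∀ x : EuclideanSpace ℝ (Fin a), ψ (x, 0) = 0)
    (hDz0 : ∀ x : EuclideanSpace ℝ (Fin a),
      fderiv ℝ (fun z : EuclideanSpace ℝ (Fin b) => ψ (x, z)) 0 = 0) :
    ∀ (x : EuclideanSpace ℝ (Fin a)) (z : EuclideanSpace ℝ (Fin b)),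
      ‖fderiv ℝ (fun x' : EuclideanSpace ℝ (Fin a) => ψ (x', z)) x‖ ≤ M * ‖z‖ ^ (1 + β) := by
  exact norm_fderiv_left_le_of_holder hβ.1 hM hψ hHol hz0 hDz0
end

section
/- Let a, b, c be positive integers, α ∈ (0,1], M ≥ 0, and let Ω : ℝ^a × ℝ^b → ℝ^c be of class C¹ with ‖DΩ(p) − DΩ(q)‖ ≤ M‖p − q‖^α for all p, q ∈ ℝ^a × ℝ^b. Assume Ω(p, 0) = 0 for every p ∈ ℝ^a. Then for all p, q ∈ ℝ^a and v ∈ ℝ^b one has ‖Ω(p, v) − Ω(q, v)‖ ≤ M‖v‖^α‖p − q‖. -/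
/-- If `DΩ` is `α`-Hölder with constant `M`, then the difference of the slices of `Ω` at heights
`v` and `w` is Lipschitz with constant `M ‖v - w‖ ^ α`. -/
theorem norm_slice_sub_slice_sub_le_of_holder_fderiv {E F G : Type*}
    [NormedAddCommGroup E] [NormedSpace ℝ E] [NormedAddCommGroup F] [NormedSpace ℝ F]
    [NormedAddCommGroup G] [NormedSpace ℝ G] {α M : ℝ} {Ω : E × F → G}
    (hΩ : Differentiable ℝ Ω)
    (hHol : ∀ x y : E × F, ‖fderiv ℝ Ω x - fderiv ℝ Ω y‖ ≤ M * ‖x - y‖ ^ α)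
    (p q : E) (v w : F) :
    ‖(Ω (p, v) - Ω (p, w)) - (Ω (q, v) - Ω (q, w))‖ ≤ M * ‖v - w‖ ^ α * ‖p - q‖ := by
  have hslice (u : F) (x : E) : HasFDerivAt (fun y => Ω (y, u))
      ((fderiv ℝ Ω (x, u)).comp (ContinuousLinearMap.inl ℝ E F)) x :=
    (hΩ (x, u)).hasFDerivAt.comp x (hasFDerivAt_prodMk_left x u)
  refine convex_univ.norm_image_sub_le_of_norm_hasFDerivWithin_le
    (f := fun x => Ω (x, v) - Ω (x, w))
    (fun x _ => ((hslice v x).sub (hslice w x)).hasFDerivWithinAt) (fun x _ => ?_)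
    (Set.mem_univ q) (Set.mem_univ p)
  have hx : ‖fderiv ℝ Ω (x, v) - fderiv ℝ Ω (x, w)‖ ≤ M * ‖v - w‖ ^ α := by
    simpa using hHol (x, v) (x, w)
  rw [← ContinuousLinearMap.sub_comp]
  calc _ ≤ ‖fderiv ℝ Ω (x, v) - fderiv ℝ Ω (x, w)‖ * ‖ContinuousLinearMap.inl ℝ E F‖ :=
        ContinuousLinearMap.opNorm_comp_le _ _
    _ ≤ ‖fderiv ℝ Ω (x, v) - fderiv ℝ Ω (x, w)‖ :=
        mul_le_of_le_one_right (norm_nonneg _) (ContinuousLinearMap.norm_inl_le_one ℝ E F)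
    _ ≤ _ := hx

/-- Let `Ω : ℝ^a × ℝ^b → ℝ^c` be `C¹` with `α`-Hölder derivative with constant
`M`, and `Ω(p, 0) = 0` for every `p`.  Then
`‖Ω(p, v) − Ω(q, v)‖ ≤ M ‖v‖^α ‖p − q‖` for all `p, q, v`. -/
theorem statement8 (a b c : ℕ) (ha : 0 < a) (hb : 0 < b) (hc : 0 < c)
    (α : ℝ) (hα : α ∈ Set.Ioc (0 : ℝ) 1) (M : ℝ) (hM : 0 ≤ M)
    (Ω : EuclideanSpace ℝ (Fin a) × EuclideanSpace ℝ (Fin b) → EuclideanSpace ℝ (Fin c))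
    (hΩ : ContDiff ℝ 1 Ω)
    (hHol : ∀ p q : EuclideanSpace ℝ (Fin a) × EuclideanSpace ℝ (Fin b),
      ‖fderiv ℝ Ω p - fderiv ℝ Ω q‖ ≤ M * ‖p - q‖ ^ α)
    (h0 : ∀ p : EuclideanSpace ℝ (Fin a), Ω (p, 0) = 0) :
    ∀ (p q : EuclideanSpace ℝ (Fin a)) (v : EuclideanSpace ℝ (Fin b)),
      ‖Ω (p, v) - Ω (q, v)‖ ≤ M * ‖v‖ ^ α * ‖p - q‖ := by
  intro p q v
  simpa [h0] using norm_slice_sub_slice_sub_le_of_holder_fderiv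
    (hΩ.differentiable one_ne_zero) hHol p q v 0
end

section
/- Let m, k be positive integers and α ∈ (0,1]. There exists a constant C > 0, depending only on m, k and α, with the following property: for every r > 0, every j ∈ {0, 1, 2}, every H ≥ 0, and every function u : ℝ^m → ℝ^k that is of class C² on the closed ball \bar B_r(0) and satisfies ‖D²u(x) − D²u(y)‖ ≤ H‖x − y‖^α for all x, y ∈ \bar B_r(0), one has sup_{x ∈ \bar B_r(0)} ‖D^j u(x)‖ ≤ C r^{−m−j} ∫_{B_r(0)} ‖u(y)‖ dy + C r^{2+α−j} H. -/
open MeasureTheory Metric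

section QuadraticPolynomial

set_option maxSynthPendingDepth 3

variable {E F : Type*} [NormedAddCommGroup E] [NormedSpace ℝ E]
  [NormedAddCommGroup F] [NormedSpace ℝ F]

/-- The polynomial map `y ↦ a + b y + c(y, y) / 2` with coefficients `p = (a, b, c)`. -/
noncomputable def quadraticPoly (p : F × (E →L[ℝ] F) × (E →L[ℝ] E →L[ℝ] F)) (y : E) : F :=
  p.1 + p.2.1 y + (1 / 2 : ℝ) • p.2.2 y y

theorem continuous_uncurry_quadraticPoly :
    Continuous (Function.uncurry (quadraticPoly (E := E) (F := F))) := by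
  unfold quadraticPoly Function.uncurry
  fun_prop

theorem continuous_quadraticPoly (p : F × (E →L[ℝ] F) × (E →L[ℝ] E →L[ℝ] F)) :
    Continuous (quadraticPoly p) := by
  unfold quadraticPoly
  fun_prop

theorem quadraticPoly_smul (t : ℝ) (p : F × (E →L[ℝ] F) × (E →L[ℝ] E →L[ℝ] F)) (y : E) :
    quadraticPoly (t • p) y = t • quadraticPoly p y := by
  simp [quadraticPoly, smul_smul, mul_comm]

theorem quadraticPoly_smul_right (t : ℝ) (a : F) (b : E →L[ℝ] F) (c : E →L[ℝ] E →L[ℝ] F)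
    (y : E) : quadraticPoly (a, b, c) (t • y) = quadraticPoly (a, t • b, t ^ 2 • c) y := by
  simp [quadraticPoly, smul_smul, mul_comm, pow_two]

/-- A quadratic polynomial with symmetric quadratic part that vanishes on the unit ball has
zero coefficients. -/
theorem eq_zero_of_quadraticPoly_eqOn_ball
    {p : F × (E →L[ℝ] F) × (E →L[ℝ] E →L[ℝ] F)} (hsymm : ∀ v w, p.2.2 v w = p.2.2 w v)
    (h : ∀ y ∈ ball (0 : E) 1, quadraticPoly p y = 0) : p = 0 := by
  obtain ⟨a, b, c⟩ := p
  have ha : a = 0 := by simpa [quadraticPoly] using h 0 (by simp)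
  subst ha
  have key (z : E) : b z = 0 ∧ c z z = 0 := by
    set t : ℝ := (‖z‖ + 1)⁻¹ with ht
    have hz : 0 < ‖z‖ + 1 := by positivity
    have htpos : 0 < t := by positivity
    have hmem : ‖t • z‖ < 1 := by
      rw [norm_smul, Real.norm_of_nonneg htpos.le, ht, inv_mul_lt_iff₀ hz]
      linarith
    have h1 := h (t • z) (by simpa using hmem)
    have h2 := h (-(t • z)) (by simpa using hmem)
    simp only [quadraticPoly, map_neg, neg_neg, neg_apply, zero_add] at h1 h2
    have hb : b (t • z) = 0 := by
      have : (2 : ℝ) • b (t • z) = 0 := by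
        rw [two_smul]
        have h3 := sub_eq_zero.2 (h1.trans h2.symm)
        rw [← h3]
        abel
      simpa using this
    rw [hb, zero_add] at h1
    constructor
    · simpa [htpos.ne'] using hb
    · simpa [htpos.ne'] using h1
  have hb : b = 0 := ContinuousLinearMap.ext fun z => (key z).1
  have hc : c = 0 := by
    ext v w
    have h1 := (key (v + w)).2
    simp only [map_add, add_apply, (key v).2, (key w).2, zero_add,
      add_zero] at h1
    rw [hsymm w v] at h1
    have : (2 : ℝ) • c v w = 0 := by rw [two_smul]; exact h1
    simpa using this
  simp [hb, hc]

variable [MeasurableSpace E] [BorelSpace E] [FiniteDimensional ℝ E]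

theorem ball_ae_eq_closedBall_of_pos (μ : Measure E) [μ.IsAddHaarMeasure] (x : E) {r : ℝ}
    (hr : 0 < r) : ball x r =ᵐ[μ] closedBall x r :=
  ae_eq_of_subset_of_measure_ge ball_subset_closedBall
    (by rw [Measure.addHaar_closedBall μ x hr.le, Measure.addHaar_ball_of_pos μ x hr])
    measurableSet_ball.nullMeasurableSet measure_closedBall_lt_top.ne

variable [FiniteDimensional ℝ F]

/-- The coefficients of a quadratic polynomial are controlled by its `L¹` norm on the unit ball. -/
theorem exists_norm_le_integral_quadraticPoly (μ : Measure E) [μ.IsAddHaarMeasure] :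
    ∃ K : ℝ, 0 ≤ K ∧ ∀ p : F × (E →L[ℝ] F) × (E →L[ℝ] E →L[ℝ] F),
      (∀ v w, p.2.2 v w = p.2.2 w v) →
        ‖p‖ ≤ K * ∫ y in ball (0 : E) 1, ‖quadraticPoly p y‖ ∂μ := by
  set V := F × (E →L[ℝ] F) × (E →L[ℝ] E →L[ℝ] F)
  have : ProperSpace V := FiniteDimensional.proper_real V
  let N : V → ℝ := fun p => ∫ y in ball (0 : E) 1, ‖quadraticPoly p y‖ ∂μ
  have hN : Continuous N := by
    have : N = fun p => ∫ y in closedBall (0 : E) 1, ‖quadraticPoly p y‖ ∂μ :=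
      funext fun p => setIntegral_congr_set (ball_ae_eq_closedBall_of_pos μ 0 one_pos)
    rw [this]
    exact continuous_parametric_integral_of_continuous continuous_uncurry_quadraticPoly.norm
      (isCompact_closedBall 0 1)
  have hNpos (p : V) (hs : ∀ v w, p.2.2 v w = p.2.2 w v) (hp : p ≠ 0) : 0 < N p := by
    have hint : IntegrableOn (fun y => ‖quadraticPoly p y‖) (ball (0 : E) 1) μ :=
      ((continuous_quadraticPoly p).norm.continuousOn.integrableOn_compact
        (isCompact_closedBall 0 1)).mono_set ball_subset_closedBall
    rw [setIntegral_pos_iff_support_of_nonneg_ae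
      (Filter.Eventually.of_forall fun y => norm_nonneg _) hint]
    refine IsOpen.measure_pos μ
      (((continuous_quadraticPoly p).norm.isOpen_support).inter isOpen_ball) ?_
    by_contra hempty
    refine hp (eq_zero_of_quadraticPoly_eqOn_ball hs fun y hy => ?_)
    by_contra hne
    exact hempty ⟨y, by simpa using hne, hy⟩
  let S : Set V := sphere 0 1 ∩ {p | ∀ v w, p.2.2 v w = p.2.2 w v}
  have hS : IsCompact S := by
    refine (isCompact_sphere 0 1).inter_right ?_
    simp only [Set.ofPred_forall]
    exact isClosed_iInter fun v => isClosed_iInter fun w =>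
      isClosed_eq (by fun_prop) (by fun_prop)
  have hSne (p : V) (hp : p ∈ S) : p ≠ 0 := ne_zero_of_mem_unit_sphere ⟨p, hp.1⟩
  obtain ⟨K, hK⟩ := hS.exists_bound_of_continuousOn (f := fun p => (N p)⁻¹)
    (hN.continuousOn.inv₀ fun p hp => (hNpos p hp.2 (hSne p hp)).ne')
  refine ⟨max K 0, le_max_right _ _, fun p hs => ?_⟩
  rcases eq_or_ne p 0 with rfl | hp
  · simpa using mul_nonneg (le_max_right K 0)
      (integral_nonneg fun y => norm_nonneg (quadraticPoly (0 : V) y))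
  have hp' : 0 < ‖p‖ := norm_pos_iff.2 hp
  have hq : ‖p‖⁻¹ • p ∈ S :=
    ⟨by simp [norm_smul, hp'.ne'], fun v w => by simp [hs v w]⟩
  have hscale : N (‖p‖⁻¹ • p) = ‖p‖⁻¹ * N p := by
    simp only [N, quadraticPoly_smul, norm_smul, norm_inv, norm_norm, integral_const_mul]
  have hbound := hK _ hq
  have hNp := hNpos p hs hp
  rw [hscale, mul_inv, inv_inv, Real.norm_of_nonneg (by positivity), ← div_eq_mul_inv,
    div_le_iff₀ hNp] at hbound
  exact hbound.trans (mul_le_mul_of_nonneg_right (le_max_left _ _) hNp.le)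

/-- Scaled version of `exists_norm_le_integral_quadraticPoly`. -/
theorem exists_norm_coeff_le_integral_quadraticPoly (μ : Measure E) [μ.IsAddHaarMeasure] :
    ∃ K : ℝ, 0 ≤ K ∧ ∀ (a : F) (b : E →L[ℝ] F) (c : E →L[ℝ] E →L[ℝ] F),
      (∀ v w, c v w = c w v) → ∀ r : ℝ, 0 < r →
        ‖(a, r • b, r ^ 2 • c)‖ ≤ K * ((r ^ Module.finrank ℝ E)⁻¹ *
          ∫ y in ball (0 : E) r, ‖quadraticPoly (a, b, c) y‖ ∂μ) := by
  obtain ⟨K, hK0, hK⟩ := exists_norm_le_integral_quadraticPoly (E := E) (F := F) μ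
  refine ⟨K, hK0, fun a b c hc r hr => ?_⟩
  have h := hK (a, r • b, r ^ 2 • c) fun v w => by simp [hc v w]
  have hint := Measure.setIntegral_comp_smul_of_pos μ
    (fun y => ‖quadraticPoly (a, b, c) y‖) (ball (0 : E) 1) hr
  simp only [quadraticPoly_smul_right, smul_unitBall_of_pos hr, smul_eq_mul] at hint
  rwa [hint] at h

end QuadraticPolynomial

section Taylor

set_option maxSynthPendingDepth 3

variable {E F : Type*} [NormedAddCommGroup E] [NormedSpace ℝ E]
  [NormedAddCommGroup F] [NormedSpace ℝ F]

theorem norm_iteratedFDerivWithin_two_le {s : Set E} (hs : UniqueDiffOn ℝ s) (u : E → F) {x : E}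
    (hx : x ∈ s) :
    ‖iteratedFDerivWithin ℝ 2 u s x‖ ≤ ‖fderivWithin ℝ (fderivWithin ℝ u s) s x‖ := by
  refine ContinuousMultilinearMap.opNorm_le_bound (norm_nonneg _) fun v => ?_
  rw [iteratedFDerivWithin_two_apply u hs hx, Fin.prod_univ_two, ← mul_assoc]
  exact ContinuousLinearMap.le_opNorm₂ _ _ _

theorem norm_fderivWithin_fderivWithin_sub_le {s : Set E} (hs : UniqueDiffOn ℝ s) (u : E → F)
    {x y : E} (hx : x ∈ s) (hy : y ∈ s) :
    ‖fderivWithin ℝ (fderivWithin ℝ u s) s x - fderivWithin ℝ (fderivWithin ℝ u s) s y‖ ≤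
      ‖iteratedFDerivWithin ℝ 2 u s x - iteratedFDerivWithin ℝ 2 u s y‖ := by
  refine ContinuousLinearMap.opNorm_le_bound₂ _ (norm_nonneg _) fun v w => ?_
  have h := (iteratedFDerivWithin ℝ 2 u s x - iteratedFDerivWithin ℝ 2 u s y).le_opNorm ![v, w]
  rw [Fin.prod_univ_two, ← mul_assoc] at h
  simpa [iteratedFDerivWithin_two_apply u hs hx, iteratedFDerivWithin_two_apply u hs hy] using h

/-- Second-order Taylor expansion at the center of a ball, with the remainder controlled by the
oscillation of the second derivative. -/
theorem taylor_two_closedBall {u : E → F} {u' : E → E →L[ℝ] F} {u'' : E → E →L[ℝ] E →L[ℝ] F}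
    {r M : ℝ} (hr : 0 ≤ r) (hM : 0 ≤ M)
    (hu : ∀ x ∈ closedBall (0 : E) r, HasFDerivWithinAt u (u' x) (closedBall 0 r) x)
    (hu' : ∀ x ∈ closedBall (0 : E) r, HasFDerivWithinAt u' (u'' x) (closedBall 0 r) x)
    (hsymm : ∀ v w, u'' 0 v w = u'' 0 w v)
    (hosc : ∀ x ∈ closedBall (0 : E) r, ‖u'' x - u'' 0‖ ≤ M)
    {x : E} (hx : x ∈ closedBall (0 : E) r) :
    ‖u' x - u' 0 - u'' 0 x‖ ≤ M * r ∧
      ‖u x - quadraticPoly (u 0, u' 0, u'' 0) x‖ ≤ M * r ^ 2 := by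
  have h0 : (0 : E) ∈ closedBall (0 : E) r := mem_closedBall_self hr
  have hle {z : E} (hz : z ∈ closedBall (0 : E) r) : ‖z‖ ≤ r := by simpa using hz
  have h1 : ∀ z ∈ closedBall (0 : E) r, ‖u' z - u' 0 - u'' 0 z‖ ≤ M * r := fun z hz => by
    have h := (convex_closedBall (0 : E) r).norm_image_sub_le_of_norm_hasFDerivWithin_le' hu' hosc
      h0 hz
    rw [sub_zero] at h
    exact h.trans (mul_le_mul_of_nonneg_left (hle hz) hM)
  refine ⟨h1 x hx, ?_⟩
  have hq (z : E) : HasFDerivAt (fun y => (1 / 2 : ℝ) • u'' 0 y y) (u'' 0 z) z := by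
    refine (((u'' 0).hasFDerivAt_of_bilinear (hasFDerivAt_id z) (hasFDerivAt_id z)).const_smul
      (1 / 2 : ℝ)).congr_fderiv (ContinuousLinearMap.ext fun v => Eq.symm ?_)
    change u'' 0 z v = (1 / 2 : ℝ) • (u'' 0 z v + u'' 0 v z)
    rw [hsymm v z, ← two_smul ℝ (u'' 0 z v), smul_smul]
    norm_num
  have h := (convex_closedBall (0 : E) r).norm_image_sub_le_of_norm_hasFDerivWithin_le'
    (f := fun y => u y - (1 / 2 : ℝ) • u'' 0 y y) (φ := u' 0)
    (fun z hz => (hu z hz).sub (hq z).hasFDerivWithinAt)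
    (fun z hz => by rw [sub_right_comm]; exact h1 z hz) h0 hx
  have heq : u x - quadraticPoly (u 0, u' 0, u'' 0) x =
      u x - (1 / 2 : ℝ) • u'' 0 x x - (u 0 - (1 / 2 : ℝ) • u'' 0 0 0) - u' 0 (x - 0) := by
    simp only [quadraticPoly, map_zero, smul_zero, sub_zero]
    abel
  rw [heq, pow_two, ← mul_assoc]
  refine h.trans (mul_le_mul_of_nonneg_left ?_ (by positivity))
  simpa using hle hx

end Taylor

section Interpolation

set_option maxSynthPendingDepth 3

variable {E F : Type*} [NormedAddCommGroup E] [NormedSpace ℝ E]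
  [NormedAddCommGroup F] [NormedSpace ℝ F]

/-- Quadratic Taylor bounds for all derivatives of order at most two, in scale-invariant form. -/
theorem pow_mul_norm_iteratedFDerivWithin_le {u : E → F} {r M : ℝ} (hr : 0 < r) (hM : 0 ≤ M)
    (hu : ContDiffOn ℝ 2 u (closedBall 0 r))
    (hosc : ∀ x ∈ closedBall (0 : E) r, ‖iteratedFDerivWithin ℝ 2 u (closedBall 0 r) x -
      iteratedFDerivWithin ℝ 2 u (closedBall 0 r) 0‖ ≤ M) :
    ∃ (a : F) (b : E →L[ℝ] F) (c : E →L[ℝ] E →L[ℝ] F), (∀ v w, c v w = c w v) ∧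
      ∀ x ∈ closedBall (0 : E) r, ‖u x - quadraticPoly (a, b, c) x‖ ≤ M * r ^ 2 ∧
        ∀ j ≤ 2, r ^ j * ‖iteratedFDerivWithin ℝ j u (closedBall 0 r) x‖ ≤
          3 * ‖(a, r • b, r ^ 2 • c)‖ + M * r ^ 2 := by
  set s := closedBall (0 : E) r with hs
  have h0 : (0 : E) ∈ s := mem_closedBall_self hr.le
  have hint : (0 : E) ∈ interior s := ball_subset_interior_closedBall (mem_ball_self hr)
  have hud : UniqueDiffOn ℝ s := uniqueDiffOn_convex (convex_closedBall 0 r) ⟨0, hint⟩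
  set u' := fderivWithin ℝ u s
  set u'' := fderivWithin ℝ u' s
  have hsymm : ∀ v w, u'' 0 v w = u'' 0 w v :=
    (hu 0 h0).isSymmSndFDerivWithinAt (by simp) hud (subset_closure hint) h0
  have hosc' : ∀ x ∈ s, ‖u'' x - u'' 0‖ ≤ M := fun x hx =>
    (norm_fderivWithin_fderivWithin_sub_le hud u hx h0).trans (hosc x hx)
  have hu' : ContDiffOn ℝ 1 u' s := hu.fderivWithin hud (by norm_num)
  refine ⟨u 0, u' 0, u'' 0, hsymm, fun x hx => ?_⟩
  obtain ⟨t1, t0⟩ := taylor_two_closedBall hr.le hM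
    (fun z hz => ((hu.differentiableOn (by norm_num)) z hz).hasFDerivWithinAt)
    (fun z hz => ((hu'.differentiableOn (by norm_num)) z hz).hasFDerivWithinAt) hsymm hosc' hx
  have t2 := hosc' x hx
  refine ⟨t0, fun j hj => ?_⟩
  have hxr : ‖x‖ ≤ r := by simpa [hs] using hx
  set Q := ‖(u 0, r • u' 0, r ^ 2 • u'' 0)‖
  have hA : ‖u 0‖ ≤ Q := norm_fst_le (u 0, r • u' 0, r ^ 2 • u'' 0)
  have hBC : ‖(r • u' 0, r ^ 2 • u'' 0)‖ ≤ Q := norm_snd_le (u 0, r • u' 0, r ^ 2 • u'' 0)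
  have hB : r * ‖u' 0‖ ≤ Q := by
    rw [← norm_smul_of_nonneg hr.le]
    exact (norm_fst_le (r • u' 0, r ^ 2 • u'' 0)).trans hBC
  have hC : r ^ 2 * ‖u'' 0‖ ≤ Q := by
    rw [← norm_smul_of_nonneg (pow_nonneg hr.le 2)]
    exact (norm_snd_le (r • u' 0, r ^ 2 • u'' 0)).trans hBC
  have hQ : 0 ≤ Q := norm_nonneg _
  have hbx : ‖u' 0 x‖ ≤ r * ‖u' 0‖ := by
    rw [mul_comm]
    exact (u' 0).le_opNorm_of_le hxr
  have hcx : ‖u'' 0 x‖ ≤ r * ‖u'' 0‖ := by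
    rw [mul_comm]
    exact (u'' 0).le_opNorm_of_le hxr
  have hcxx : ‖u'' 0 x x‖ ≤ r ^ 2 * ‖u'' 0‖ :=
    calc ‖u'' 0 x x‖ ≤ ‖u'' 0 x‖ * r := (u'' 0 x).le_opNorm_of_le hxr
      _ ≤ r * ‖u'' 0‖ * r := mul_le_mul_of_nonneg_right hcx hr.le
      _ = r ^ 2 * ‖u'' 0‖ := by ring
  interval_cases j
  · rw [norm_iteratedFDerivWithin_zero, pow_zero, one_mul]
    have hP : ‖quadraticPoly (u 0, u' 0, u'' 0) x‖ ≤ 3 * Q := by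
      refine (norm_add₃_le).trans ?_
      rw [norm_smul]
      norm_num
      linarith [norm_nonneg (u'' 0 x x)]
    linarith [norm_le_norm_add_norm_sub' (u x) (quadraticPoly (u 0, u' 0, u'' 0) x)]
  · rw [norm_iteratedFDerivWithin_one u (hud x hx), pow_one]
    have h : ‖u' x‖ ≤ ‖u' 0‖ + r * ‖u'' 0‖ + M * r := by
      have h1 := norm_le_norm_add_norm_sub' (u' x) (u' 0 + u'' 0 x)
      rw [← sub_sub] at h1
      linarith [norm_add_le (u' 0) (u'' 0 x)]
    nlinarith [mul_le_mul_of_nonneg_left h hr.le]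
  · have h : ‖iteratedFDerivWithin ℝ 2 u s x‖ ≤ ‖u'' 0‖ + M :=
      (norm_iteratedFDerivWithin_two_le hud u hx).trans
        ((norm_le_norm_add_norm_sub' _ _).trans (add_le_add_right t2 _))
    nlinarith [mul_le_mul_of_nonneg_left h (pow_nonneg hr.le 2)]

/-- Interpolation between `L¹` and the oscillation of the second derivative on a ball. -/
theorem exists_pow_mul_norm_iteratedFDerivWithin_le (E F : Type*)
    [NormedAddCommGroup E] [NormedSpace ℝ E] [NormedAddCommGroup F] [NormedSpace ℝ F]
    [MeasurableSpace E] [BorelSpace E] [FiniteDimensional ℝ E] [FiniteDimensional ℝ F]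
    (μ : Measure E) [μ.IsAddHaarMeasure] :
    ∃ C : ℝ, 0 < C ∧ ∀ (u : E → F) (r M : ℝ), 0 < r → 0 ≤ M →
      ContDiffOn ℝ 2 u (closedBall 0 r) →
      (∀ x ∈ closedBall (0 : E) r, ‖iteratedFDerivWithin ℝ 2 u (closedBall 0 r) x -
        iteratedFDerivWithin ℝ 2 u (closedBall 0 r) 0‖ ≤ M) →
      ∀ x ∈ closedBall (0 : E) r, ∀ j ≤ 2,
        r ^ j * ‖iteratedFDerivWithin ℝ j u (closedBall 0 r) x‖ ≤
          C * ((r ^ Module.finrank ℝ E)⁻¹ * ∫ y in ball (0 : E) r, ‖u y‖ ∂μ) +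
            C * (M * r ^ 2) := by
  obtain ⟨K, hK0, hK⟩ := exists_norm_coeff_le_integral_quadraticPoly (E := E) (F := F) μ
  set ω := μ.real (ball (0 : E) 1)
  have hω : 0 ≤ ω := measureReal_nonneg
  refine ⟨3 * K + 3 * K * ω + 1, by positivity, fun u r M hr hM hu hosc x hx j hj => ?_⟩
  obtain ⟨a, b, c, hc, h⟩ := pow_mul_norm_iteratedFDerivWithin_le hr hM hu hosc
  have hcoeff := hK a b c hc r hr
  have hd : 0 < r ^ Module.finrank ℝ E := by positivity
  set d := r ^ Module.finrank ℝ E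
  have hvol : μ.real (ball (0 : E) r) = d * ω := by
    rw [measureReal_congr (ball_ae_eq_closedBall_of_pos μ 0 hr),
      Measure.addHaar_real_closedBall μ 0 hr.le]
  have huint : IntegrableOn (fun y => ‖u y‖) (ball (0 : E) r) μ :=
    (hu.continuousOn.norm.integrableOn_compact (isCompact_closedBall 0 r)).mono_set
      ball_subset_closedBall
  have hpint : IntegrableOn (fun y => ‖quadraticPoly (a, b, c) y‖) (ball (0 : E) r) μ :=
    ((continuous_quadraticPoly (a, b, c)).norm.continuousOn.integrableOn_compact
      (isCompact_closedBall 0 r)).mono_set ball_subset_closedBall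
  have hconst : IntegrableOn (fun _ : E => M * r ^ 2) (ball (0 : E) r) μ :=
    integrableOn_const measure_ball_lt_top.ne
  have hle : ∫ y in ball (0 : E) r, ‖quadraticPoly (a, b, c) y‖ ∂μ ≤
      (∫ y in ball (0 : E) r, ‖u y‖ ∂μ) + d * ω * (M * r ^ 2) := by
    rw [← hvol, ← smul_eq_mul, ← setIntegral_const, ← integral_add huint hconst]
    refine setIntegral_mono_on hpint (huint.add hconst) measurableSet_ball fun y hy => ?_
    have h1 := (h y (ball_subset_closedBall hy)).1
    linarith [norm_le_norm_add_norm_sub (u y) (quadraticPoly (a, b, c) y)]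
  set I := ∫ y in ball (0 : E) r, ‖u y‖ ∂μ
  have hI : 0 ≤ I := integral_nonneg fun y => norm_nonneg _
  have hle' : K * (d⁻¹ * ∫ y in ball (0 : E) r, ‖quadraticPoly (a, b, c) y‖ ∂μ) ≤
      K * (d⁻¹ * I) + K * ω * (M * r ^ 2) :=
    calc _ ≤ K * (d⁻¹ * (I + d * ω * (M * r ^ 2))) := by gcongr
      _ = _ := by field_simp
  have hj := (h x hx).2 j hj
  have hI' : 0 ≤ d⁻¹ * I := by positivity
  have hM' : 0 ≤ M * r ^ 2 := by positivity
  nlinarith [mul_nonneg hK0 hM', mul_nonneg (mul_nonneg hK0 hω) hI']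

end Interpolation


/-- interior interpolation estimate.  There is `C > 0` depending only on
`m, k, α` such that for every `r > 0`, every `j ∈ {0,1,2}`, every `H ≥ 0`, and every
`u : ℝ^m → ℝ^k` of class `C²` on `closedBall 0 r` whose second derivative (taken within
the closed ball) is `α`-Hölder with constant `H` there, one has
`sup_{x ∈ closedBall 0 r} ‖D^j u(x)‖ ≤ C r^{-m-j} ∫_{B_r(0)} ‖u‖ + C r^{2+α-j} H`. -/
theorem statement9 (m k : ℕ) (hm : 0 < m) (hk : 0 < k)
    (α : ℝ) (hα : α ∈ Set.Ioc (0 : ℝ) 1) :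
    ∃ C : ℝ, 0 < C ∧
      ∀ (r : ℝ), 0 < r → ∀ (j : ℕ), j ≤ 2 → ∀ (H : ℝ), 0 ≤ H →
        ∀ u : EuclideanSpace ℝ (Fin m) → EuclideanSpace ℝ (Fin k),
          ContDiffOn ℝ 2 u (Metric.closedBall 0 r) →
          (∀ x ∈ Metric.closedBall (0 : EuclideanSpace ℝ (Fin m)) r,
            ∀ y ∈ Metric.closedBall (0 : EuclideanSpace ℝ (Fin m)) r,
              ‖iteratedFDerivWithin ℝ 2 u (Metric.closedBall 0 r) x -
                iteratedFDerivWithin ℝ 2 u (Metric.closedBall 0 r) y‖ ≤ H * ‖x - y‖ ^ α) →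
          ∀ x ∈ Metric.closedBall (0 : EuclideanSpace ℝ (Fin m)) r,
            ‖iteratedFDerivWithin ℝ j u (Metric.closedBall 0 r) x‖ ≤
              C * r ^ (-(m : ℝ) - (j : ℝ)) *
                  (∫ y in Metric.ball (0 : EuclideanSpace ℝ (Fin m)) r, ‖u y‖) +
                C * r ^ (2 + α - (j : ℝ)) * H := by
  obtain ⟨C, hC, h⟩ := exists_pow_mul_norm_iteratedFDerivWithin_le
    (EuclideanSpace ℝ (Fin m)) (EuclideanSpace ℝ (Fin k)) volume
  refine ⟨C, hC, fun r hr j hj H hH u hu hosc x hx => ?_⟩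
  have hrα : 0 ≤ r ^ α := Real.rpow_nonneg hr.le α
  have hj := h u r (H * r ^ α) hr (by positivity) hu (fun y hy => ?_) x hx j hj
  · rw [finrank_euclideanSpace_fin] at hj
    have e1 : r ^ (-(m : ℝ) - (j : ℝ)) = (r ^ m)⁻¹ / r ^ j := by
      rw [Real.rpow_sub hr, Real.rpow_neg hr.le, Real.rpow_natCast, Real.rpow_natCast]
    have e2 : r ^ (2 + α - (j : ℝ)) = r ^ 2 * r ^ α / r ^ j := by
      rw [Real.rpow_sub hr, Real.rpow_add hr, Real.rpow_natCast, Real.rpow_two]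
    rw [e1, e2]
    refine le_of_mul_le_mul_left (hj.trans_eq ?_) (pow_pos hr j)
    field_simp
  · refine (hosc y hy 0 (mem_closedBall_self hr.le)).trans (mul_le_mul_of_nonneg_left ?_ hH)
    exact Real.rpow_le_rpow (norm_nonneg _) (by simpa using hy) hα.1.le
end

section
/- Let m, k be positive integers and κ ∈ (0,1]. There exists a constant C > 0, depending only on m, k and κ, with the following property: for every r > 0, every j ∈ {0, 1, 2, 3}, every K ≥ 0, and every function u : ℝ^m → ℝ^k that is of class C³ on the closed ball \bar B_r(0) and satisfies ‖D³u(x) − D³u(y)‖ ≤ K‖x − y‖^κ for all x, y ∈ \bar B_r(0), one has sup_{x ∈ \bar B_r(0)} ‖D^j u(x)‖ ≤ C r^{−m−j} ∫_{B_r(0)} ‖u(y)‖ dy + C r^{3+κ−j} K. -/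
open MeasureTheory Metric Set Filter Topology
open scoped Nat

section Symmetry

variable {E F : Type*} [NormedAddCommGroup E] [NormedSpace ℝ E]
  [NormedAddCommGroup F] [NormedSpace ℝ F]

/-- The `n`-th derivative of a `C^n` function is invariant under adjacent transpositions. -/
theorem ContDiffAt.iteratedFDeriv_comp_swap {f : E → F} {n : ℕ} {x : E}
    (hf : ContDiffAt ℝ (n + 1 : ℕ) f x) (i : Fin n) (v : Fin (n + 1) → E) :
    iteratedFDeriv ℝ (n + 1) f x (v ∘ Equiv.swap i.castSucc i.succ) =
      iteratedFDeriv ℝ (n + 1) f x v := by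
  induction n generalizing x with
  | zero => exact i.elim0
  | succ n ih =>
    have hd : DifferentiableAt ℝ (iteratedFDeriv ℝ (n + 1) f) x :=
      hf.differentiableAt_iteratedFDeriv (by norm_cast; omega)
    refine Fin.cases ?_ (fun j ↦ ?_) i
    · have hdd : DifferentiableAt ℝ (fderiv ℝ (iteratedFDeriv ℝ n f)) x :=
        ((hf.iteratedFDeriv_right (i := n) (m := 2) (by norm_cast; omega)).fderiv_right
          (m := 1) (by norm_num)).differentiableAt (by simp)
      have key : ∀ w : Fin (n + 2) → E, iteratedFDeriv ℝ (n + 2) f x w =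
          fderiv ℝ (fderiv ℝ (iteratedFDeriv ℝ n f)) x (w 0) (w 1) (Fin.tail (Fin.tail w)) := by
        intro w
        rw [iteratedFDeriv_succ_apply_left, ← fderiv_continuousMultilinear_apply_const_apply hd]
        have h := fderiv_clm_apply hdd (differentiableAt_const (w 1))
        change fderiv ℝ (fun y ↦ fderiv ℝ (iteratedFDeriv ℝ n f) y (w 1) (Fin.tail (Fin.tail w))) x
          (w 0) = _
        rw [fderiv_continuousMultilinear_apply_const_apply
          (hdd.clm_apply (differentiableAt_const (w 1))), h]
        simp
      have hs : IsSymmSndFDerivAt ℝ (iteratedFDeriv ℝ n f) x :=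
        (hf.iteratedFDeriv_right (i := n) (m := 2) (by norm_cast; omega)).isSymmSndFDerivAt
          (by simp)
      rw [key, key, hs.eq]
      congr 1
    · have hev : ∀ᶠ y in 𝓝 x, iteratedFDeriv ℝ (n + 1) f y
          (Fin.tail v ∘ Equiv.swap j.castSucc j.succ) = iteratedFDeriv ℝ (n + 1) f y (Fin.tail v) := by
        filter_upwards [hf.eventually (by simp)] with y hy
        exact ih (hy.of_le (by norm_cast; omega)) j _
      have htail : Fin.tail (v ∘ Equiv.swap j.succ.castSucc j.succ.succ) =
          Fin.tail v ∘ Equiv.swap j.castSucc j.succ := by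
        ext1 l
        simp only [Fin.tail, Function.comp_apply, Fin.castSucc_succ]
        rw [← (Fin.succ_injective _).map_swap]
      have hzero : (v ∘ Equiv.swap j.succ.castSucc j.succ.succ) 0 = v 0 := by
        rw [Function.comp_apply, Equiv.swap_apply_of_ne_of_ne] <;>
          simp [Fin.ext_iff]
      rw [iteratedFDeriv_succ_apply_left, iteratedFDeriv_succ_apply_left, htail, hzero,
        ← fderiv_continuousMultilinear_apply_const_apply hd,
        ← fderiv_continuousMultilinear_apply_const_apply hd, EventuallyEq.fderiv_eq hev]

/-- The `n`-th derivative of a `C^n` function is symmetric. -/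
theorem ContDiffAt.iteratedFDeriv_comp_perm_of_natCast {f : E → F} {n : ℕ} {x : E}
    (hf : ContDiffAt ℝ n f x) (v : Fin n → E) (σ : Equiv.Perm (Fin n)) :
    iteratedFDeriv ℝ n f x (v ∘ σ) = iteratedFDeriv ℝ n f x v := by
  cases n with
  | zero => congr 1; exact Subsingleton.elim _ _
  | succ n =>
    have hσ : σ ∈ Submonoid.closure (Set.range fun i : Fin n ↦ Equiv.swap i.castSucc i.succ) := by
      rw [Equiv.Perm.mclosure_swap_castSucc_succ]; trivial
    induction hσ using Submonoid.closure_induction generalizing v with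
    | mem τ hτ =>
      obtain ⟨i, rfl⟩ := hτ
      exact hf.iteratedFDeriv_comp_swap i v
    | one => rfl
    | mul τ ρ _ _ hτ hρ => rw [Equiv.Perm.coe_mul, ← Function.comp_assoc, hρ, hτ]

end Symmetry

section Taylor

variable {E F : Type*} [NormedAddCommGroup E] [NormedSpace ℝ E]
  [NormedAddCommGroup F] [NormedSpace ℝ F]

/-- The polynomial of degree at most three with derivatives at the origin given by `c`. -/
noncomputable def cubicPoly (c : ∀ i : Fin 4, E [×i]→L[ℝ] F) (x : E) : F :=
  ∑ i : Fin 4, ((i : ℕ)! : ℝ)⁻¹ • c i (fun _ ↦ x)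

theorem cubicPoly_eq (c : ∀ i : Fin 4, E [×i]→L[ℝ] F) (x : E) :
    cubicPoly c x = c 0 (fun _ ↦ x) + c 1 (fun _ ↦ x) + (2 : ℝ)⁻¹ • c 2 (fun _ ↦ x) +
      (6 : ℝ)⁻¹ • c 3 (fun _ ↦ x) := by
  have h3 : (3 ! : ℝ) = 6 := by norm_num [Nat.factorial]
  simp [cubicPoly, Fin.sum_univ_four, h3]

theorem continuous_cubicPoly (c : ∀ i : Fin 4, E [×i]→L[ℝ] F) : Continuous (cubicPoly c) := by
  unfold cubicPoly
  fun_prop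

theorem cubicPoly_smul (c : ∀ i : Fin 4, E [×i]→L[ℝ] F) (t : ℝ) (x : E) :
    cubicPoly c (t • x) = cubicPoly (fun i ↦ t ^ (i : ℕ) • c i) x := by
  refine Finset.sum_congr rfl fun i _ ↦ ?_
  have := (c i).map_smul_univ (fun _ ↦ t) (fun _ ↦ x)
  simp only [Finset.prod_const, Finset.card_univ, Fintype.card_fin] at this
  rw [this]
  rfl

/-- Derivative along a segment from the origin of an iterated derivative on the diagonal. -/
theorem hasDerivWithinAt_iteratedFDerivWithin_diagonal {s : Set E} (hs : Convex ℝ s)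
    (hs' : UniqueDiffOn ℝ s) (h0 : (0 : E) ∈ s) {u : E → F} {n i : ℕ} (hu : ContDiffOn ℝ n u s)
    (hi : i < n) {x : E} (hx : x ∈ s) {t : ℝ} (ht : t ∈ Icc (0 : ℝ) 1) :
    HasDerivWithinAt (fun τ : ℝ ↦ iteratedFDerivWithin ℝ i u s (τ • x) (fun _ ↦ x))
      (iteratedFDerivWithin ℝ (i + 1) u s (t • x) (fun _ ↦ x)) (Icc 0 1) t := by
  have hmaps : MapsTo (fun τ : ℝ ↦ τ • x) (Icc 0 1) s := fun τ hτ ↦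
    hs.smul_mem_of_zero_mem h0 hx hτ
  have hd := (hu.differentiableOn_iteratedFDerivWithin (m := i) (by exact_mod_cast hi) hs' (t • x)
    (hmaps ht)).hasFDerivWithinAt
  have hl : HasDerivWithinAt (fun τ : ℝ ↦ τ • x) x (Icc 0 1) t := by
    simpa using ((hasDerivAt_id t).smul_const x).hasDerivWithinAt
  have hc := hd.comp_hasDerivWithinAt t hl hmaps
  exact (ContinuousMultilinearMap.apply ℝ (fun _ : Fin i ↦ E) F
    (fun _ ↦ x)).hasFDerivAt.comp_hasDerivWithinAt t hc

/-- A function on `[0, 1]` vanishing at the origin is bounded by a bound of its derivative. -/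
theorem norm_le_of_hasDerivWithinAt_Icc {f f' : ℝ → F} {C : ℝ}
    (hf : ∀ t ∈ Icc (0 : ℝ) 1, HasDerivWithinAt f (f' t) (Icc 0 1) t) (h0 : f 0 = 0)
    (hC : 0 ≤ C) (hb : ∀ t ∈ Icc (0 : ℝ) 1, ‖f' t‖ ≤ C) : ∀ t ∈ Icc (0 : ℝ) 1, ‖f t‖ ≤ C := by
  intro t ht
  have h := (convex_Icc (0 : ℝ) 1).norm_image_sub_le_of_norm_hasDerivWithin_le hf hb
    (left_mem_Icc.2 zero_le_one) ht
  rw [h0, sub_zero, sub_zero, Real.norm_of_nonneg ht.1] at h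
  nlinarith [ht.2]

/-- Taylor's formula of order three at the origin of a convex set. -/
theorem norm_sub_cubicPoly_le {s : Set E} (hs : Convex ℝ s) (hs' : UniqueDiffOn ℝ s)
    (h0 : (0 : E) ∈ s) {u : E → F} (hu : ContDiffOn ℝ 3 u s) {x : E} (hx : x ∈ s) {M : ℝ}
    (hM : ∀ y ∈ s, ‖iteratedFDerivWithin ℝ 3 u s y - iteratedFDerivWithin ℝ 3 u s 0‖ ≤ M) :
    ‖u x - cubicPoly (fun i ↦ iteratedFDerivWithin ℝ i u s 0) x‖ ≤ M * ‖x‖ ^ 3 := by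
  set g : ℕ → ℝ → F := fun i τ ↦ iteratedFDerivWithin ℝ i u s (τ • x) (fun _ ↦ x) with hg
  have hder : ∀ i < 3, ∀ t ∈ Icc (0 : ℝ) 1, HasDerivWithinAt (g i) (g (i + 1) t) (Icc 0 1) t :=
    fun i hi t ht ↦ hasDerivWithinAt_iteratedFDerivWithin_diagonal hs hs' h0
      (by exact_mod_cast hu) hi hx ht
  have hpow : ∀ (n : ℕ) (t : ℝ) (c : F), HasDerivWithinAt
      (fun τ : ℝ ↦ τ ^ (n + 1) • c) (((n + 1 : ℝ) * t ^ n) • c) (Icc 0 1) t := fun n t c ↦ by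
    simpa using ((hasDerivAt_pow (n + 1) t).smul_const c).hasDerivWithinAt
  have hMx : 0 ≤ M * ‖x‖ ^ 3 :=
    mul_nonneg ((norm_nonneg _).trans (hM 0 h0)) (by positivity)
  have h3 : ∀ t ∈ Icc (0 : ℝ) 1, ‖g 3 t - g 3 0‖ ≤ M * ‖x‖ ^ 3 := by
    intro t ht
    have h := (iteratedFDerivWithin ℝ 3 u s (t • x) -
      iteratedFDerivWithin ℝ 3 u s 0).le_opNorm (fun _ ↦ x)
    simp only [Finset.prod_const, Finset.card_univ, Fintype.card_fin] at h
    simp only [hg, zero_smul]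
    refine h.trans ?_
    gcongr
    exact hM _ (hs.smul_mem_of_zero_mem h0 hx ht)
  have h2 : ∀ t ∈ Icc (0 : ℝ) 1, ‖g 2 t - g 2 0 - t • g 3 0‖ ≤ M * ‖x‖ ^ 3 := by
    refine norm_le_of_hasDerivWithinAt_Icc (fun t ht ↦ ?_) (by simp) hMx h3
    refine (((hder 2 (by norm_num) t ht).sub_const (g 2 0)).sub (hpow 0 t (g 3 0))).congr_deriv ?_
      |>.congr_of_mem ?_ ht
    · norm_num
    · intro τ _; simp
  have h1 : ∀ t ∈ Icc (0 : ℝ) 1,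
      ‖g 1 t - g 1 0 - t • g 2 0 - t ^ 2 • (2 : ℝ)⁻¹ • g 3 0‖ ≤ M * ‖x‖ ^ 3 := by
    refine norm_le_of_hasDerivWithinAt_Icc (fun t ht ↦ ?_) (by simp) hMx h2
    refine ((((hder 1 (by norm_num) t ht).sub_const (g 1 0)).sub (hpow 0 t (g 2 0))).sub
      (hpow 1 t ((2 : ℝ)⁻¹ • g 3 0))).congr_deriv ?_ |>.congr_of_mem ?_ ht
    · norm_num; module
    · intro τ _; simp
  have h := norm_le_of_hasDerivWithinAt_Icc
    (f := fun t ↦ g 0 t - g 0 0 - t • g 1 0 - t ^ 2 • (2 : ℝ)⁻¹ • g 2 0 -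
      t ^ 3 • (6 : ℝ)⁻¹ • g 3 0) (fun t ht ↦ ?_) (by simp) hMx h1 1 (right_mem_Icc.2 zero_le_one)
  · refine le_of_eq_of_le (congrArg _ ?_) h
    rw [cubicPoly_eq]
    simp [hg]
    abel
  · refine (((((hder 0 (by norm_num) t ht).sub_const (g 0 0)).sub (hpow 0 t (g 1 0))).sub
      (hpow 1 t ((2 : ℝ)⁻¹ • g 2 0))).sub (hpow 2 t ((6 : ℝ)⁻¹ • g 3 0))).congr_deriv ?_
      |>.congr_of_mem ?_ ht
    · norm_num; module
    · intro τ _; simp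

end Taylor

section Coefficients

variable {E F : Type*} [NormedAddCommGroup E] [NormedSpace ℝ E]
  [NormedAddCommGroup F] [NormedSpace ℝ F]

variable (E F) in
/-- Coefficients of cubic polynomials given by symmetric multilinear maps. -/
def symmetricCoeffs : Submodule ℝ (∀ i : Fin 4, E [×i]→L[ℝ] F) where
  carrier := {c | ∀ (i : Fin 4) v, ∀ σ : Equiv.Perm (Fin i), c i (v ∘ σ) = c i v}
  add_mem' ha hb i v σ := by simp [ha i v σ, hb i v σ]
  zero_mem' i v σ := rfl
  smul_mem' t c hc i v σ := by simp [hc i v σ]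

theorem cubicPoly_add (c d : ∀ i : Fin 4, E [×i]→L[ℝ] F) :
    cubicPoly (c + d) = cubicPoly c + cubicPoly d := by
  ext x
  simp [cubicPoly, Finset.sum_add_distrib]

theorem cubicPoly_const_smul (t : ℝ) (c : ∀ i : Fin 4, E [×i]→L[ℝ] F) :
    cubicPoly (t • c) = t • cubicPoly c := by
  ext x
  simp [cubicPoly, Finset.smul_sum, smul_comm t]

/-- A symmetric multilinear map vanishing on the diagonal near the origin is zero. -/
theorem ContinuousMultilinearMap.eq_zero_of_symmetric_of_diagonal {n : ℕ} {f : E [×n]→L[ℝ] F}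
    (hf : ∀ v, ∀ σ : Equiv.Perm (Fin n), f (v ∘ σ) = f v)
    (h : ∀ᶠ x in 𝓝 (0 : E), f (fun _ ↦ x) = 0) : f = 0 := by
  ext v
  have h1 : iteratedFDeriv ℝ n (fun x ↦ f (fun _ ↦ x)) 0 v = 0 := by
    rw [(show (fun x ↦ f (fun _ ↦ x)) =ᶠ[𝓝 0] fun _ ↦ (0 : F) from h).iteratedFDeriv ℝ n
      |>.eq_of_nhds]
    simp
  rw [f.iteratedFDeriv_comp_diagonal,
    Finset.sum_congr rfl fun (σ : Equiv.Perm (Fin n)) _ ↦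
      show f (fun i ↦ v (σ i)) = f v from hf v σ] at h1
  simpa [Fintype.card_perm, ← Nat.cast_smul_eq_nsmul ℝ, Nat.factorial_ne_zero] using h1

/-- A cubic polynomial vanishing on the unit ball has vanishing symmetric coefficients. -/
theorem eq_zero_of_cubicPoly_eqOn_zero {c : ∀ i : Fin 4, E [×i]→L[ℝ] F}
    (hc : c ∈ symmetricCoeffs E F) (h : ∀ x ∈ ball (0 : E) 1, cubicPoly c x = 0) : c = 0 := by
  have key : ∀ x ∈ ball (0 : E) 1, c 0 (fun _ ↦ x) = 0 ∧ c 1 (fun _ ↦ x) = 0 ∧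
      c 2 (fun _ ↦ x) = 0 ∧ c 3 (fun _ ↦ x) = 0 := by
    intro x hx
    have ht : ∀ t : ℝ, |t| ≤ 1 → c 0 (fun _ ↦ x) + t • c 1 (fun _ ↦ x) +
        (2 : ℝ)⁻¹ • t ^ 2 • c 2 (fun _ ↦ x) + (6 : ℝ)⁻¹ • t ^ 3 • c 3 (fun _ ↦ x) = 0 := by
      intro t ht
      have hmem : t • x ∈ ball (0 : E) 1 := by
        rw [mem_ball_zero_iff, norm_smul, Real.norm_eq_abs] at *
        nlinarith [norm_nonneg x]
      have h0 := h _ hmem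
      rw [cubicPoly_smul, cubicPoly_eq] at h0
      simpa using h0
    have e1 := ht 1 (by norm_num)
    have e2 := ht (-1) (by norm_num)
    have e3 := ht 2⁻¹ (by norm_num [abs_of_pos])
    have e4 := ht (-2⁻¹) (by norm_num [abs_of_pos])
    refine ⟨?_, ?_, ?_, ?_⟩
    · linear_combination (norm := module) (-1/6 : ℝ) • e1 + (-1/6 : ℝ) • e2 + (2/3 : ℝ) • e3 +
        (2/3 : ℝ) • e4
    · linear_combination (norm := module) (-1/6 : ℝ) • e1 + (1/6 : ℝ) • e2 + (4/3 : ℝ) • e3 -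
        (4/3 : ℝ) • e4
    · linear_combination (norm := module) (4/3 : ℝ) • e1 + (4/3 : ℝ) • e2 - (4/3 : ℝ) • e3 -
        (4/3 : ℝ) • e4
    · linear_combination (norm := module) (4 : ℝ) • e1 - (4 : ℝ) • e2 - (8 : ℝ) • e3 +
        (8 : ℝ) • e4
  have hev : ∀ᶠ x in 𝓝 (0 : E), x ∈ ball (0 : E) 1 := ball_mem_nhds _ one_pos
  funext i
  refine ContinuousMultilinearMap.eq_zero_of_symmetric_of_diagonal (hc i) ?_
  filter_upwards [hev] with x hx
  obtain ⟨h0, h1, h2, h3⟩ := key x hx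
  fin_cases i <;> assumption

variable [FiniteDimensional ℝ E] [FiniteDimensional ℝ F]

instance ContinuousMultilinearMap.instFiniteDimensional (n : ℕ) :
    FiniteDimensional ℝ (E [×n]→L[ℝ] F) :=
  FiniteDimensional.of_injective
    (ContinuousMultilinearMap.toMultilinearMapLinear (R' := ℝ) (A := ℝ)
      (M₁ := fun _ : Fin n ↦ E) (M₂ := F))
    ContinuousMultilinearMap.toMultilinearMap_injective

variable [MeasurableSpace E] [BorelSpace E] (μ : Measure E) [μ.IsAddHaarMeasure]

/-- On the unit ball, symmetric coefficients are controlled by the `L¹` norm. -/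
theorem exists_norm_le_integral_norm_cubicPoly : ∃ C : ℝ, 0 < C ∧
    ∀ c ∈ symmetricCoeffs E F, ‖c‖ ≤ C * ∫ x in ball (0 : E) 1, ‖cubicPoly c x‖ ∂μ := by
  have hint (c : ∀ i : Fin 4, E [×i]→L[ℝ] F) :
      Integrable (cubicPoly c) (μ.restrict (ball 0 1)) :=
    ((continuous_cubicPoly c).continuousOn.integrableOn_compact (isCompact_closedBall 0 1)).mono_set
      ball_subset_closedBall
  let J : symmetricCoeffs E F →ₗ[ℝ] (E →₁[μ.restrict (ball 0 1)] F) :=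
    { toFun := fun c ↦ (hint c).toL1 _
      map_add' := fun c d ↦ by
        simp only [Submodule.coe_add, cubicPoly_add]
        exact Integrable.toL1_add _ _ (hint c) (hint d)
      map_smul' := fun t c ↦ by
        simp only [Submodule.coe_smul, cubicPoly_const_smul]
        exact Integrable.toL1_smul _ (hint c) t }
  have hJ (c : symmetricCoeffs E F) : ‖J c‖ = ∫ x in ball (0 : E) 1, ‖cubicPoly c.1 x‖ ∂μ :=
    L1.norm_of_fun_eq_integral_norm (hint c)
  have hker : LinearMap.ker J = ⊥ := by
    refine LinearMap.ker_eq_bot'.2 fun c hc ↦ Subtype.ext ?_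
    refine eq_zero_of_cubicPoly_eqOn_zero c.2 fun x hx ↦ ?_
    have hae : cubicPoly (c : ∀ i : Fin 4, E [×i]→L[ℝ] F) =ᵐ[μ.restrict (ball 0 1)] 0 :=
      (Integrable.toL1_eq_toL1_iff _ _ (hint c) (integrable_zero _ _ _)).1
        (hc.trans (Integrable.toL1_zero _).symm)
    exact Measure.eqOn_open_of_ae_eq hae isOpen_ball (continuous_cubicPoly _).continuousOn
      continuousOn_const hx
  obtain ⟨K, hK, hK'⟩ := @LinearMap.exists_antilipschitzWith ℝ _ (symmetricCoeffs E F) _ _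
    (E →₁[μ.restrict (ball 0 1)] F) _ _ _ _ J hker
  refine ⟨K, hK, fun c hc ↦ ?_⟩
  rw [← hJ ⟨c, hc⟩]
  simpa using! ZeroHomClass.bound_of_antilipschitz J hK' ⟨c, hc⟩

/-- Scale-invariant control of symmetric coefficients by the `L¹` norm on a ball. -/
theorem exists_norm_coeff_le_integral_norm_cubicPoly : ∃ C : ℝ, 0 < C ∧
    ∀ c ∈ symmetricCoeffs E F, ∀ r > 0, ∀ i : Fin 4, r ^ (i : ℕ) * ‖c i‖ ≤
      C * ((r ^ Module.finrank ℝ E)⁻¹ * ∫ x in ball (0 : E) r, ‖cubicPoly c x‖ ∂μ) := by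
  obtain ⟨C, hC, h⟩ := exists_norm_le_integral_norm_cubicPoly (E := E) (F := F) μ
  refine ⟨C, hC, fun c hc r hr i ↦ ?_⟩
  have hmem : (fun i : Fin 4 ↦ r ^ (i : ℕ) • c i) ∈ symmetricCoeffs E F := fun i v σ ↦ by
    simp [hc i v σ]
  have hi := (norm_le_pi_norm (fun i : Fin 4 ↦ r ^ (i : ℕ) • c i) i).trans (h _ hmem)
  rw [norm_smul, Real.norm_of_nonneg (by positivity)] at hi
  refine hi.trans_eq ?_
  simp_rw [← cubicPoly_smul]
  rw [Measure.setIntegral_comp_smul_of_pos μ (fun x ↦ ‖cubicPoly c x‖) _ hr,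
    smul_unitBall_of_pos hr, smul_eq_mul]

end Coefficients

section Interpolation

variable {E F : Type*} [NormedAddCommGroup E] [NormedSpace ℝ E]
  [NormedAddCommGroup F] [NormedSpace ℝ F]

/-- Bounds of the derivatives at the origin propagate to a ball, given a bound for the next
derivative. -/
theorem norm_iteratedFDerivWithin_le_of_succ {r : ℝ} {u : E → F} {n i : ℕ} (hr : 0 < r)
    (hu : ContDiffOn ℝ n u (closedBall 0 r)) (hi : i < n) {A B : ℝ}
    (hA : r ^ i * ‖iteratedFDerivWithin ℝ i u (closedBall 0 r) 0‖ ≤ A)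
    (hB : ∀ x ∈ closedBall (0 : E) r,
      r ^ (i + 1) * ‖iteratedFDerivWithin ℝ (i + 1) u (closedBall 0 r) x‖ ≤ B) :
    ∀ x ∈ closedBall (0 : E) r,
      r ^ i * ‖iteratedFDerivWithin ℝ i u (closedBall 0 r) x‖ ≤ A + B := by
  intro x hx
  have hconv := convex_closedBall (0 : E) r
  have huniq : UniqueDiffOn ℝ (closedBall (0 : E) r) :=
    uniqueDiffOn_convex hconv ⟨0, ball_subset_interior_closedBall (mem_ball_self hr)⟩
  have h0 : (0 : E) ∈ closedBall (0 : E) r := mem_closedBall_self hr.le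
  have hmv := hconv.norm_image_sub_le_of_norm_fderivWithin_le (C := B / r ^ (i + 1))
    (hu.differentiableOn_iteratedFDerivWithin (m := i) (by exact_mod_cast hi) huniq)
    (fun y hy ↦ by
      rw [norm_fderivWithin_iteratedFDerivWithin, le_div_iff₀' (by positivity)]
      exact hB y hy) h0 hx
  have hB0 : 0 ≤ B := (by positivity : (0 : ℝ) ≤ _).trans (hB 0 h0)
  have hxr : ‖x - 0‖ ≤ r := by simpa using hx
  have hmv' : r ^ i * ‖iteratedFDerivWithin ℝ i u (closedBall 0 r) x -
      iteratedFDerivWithin ℝ i u (closedBall 0 r) 0‖ ≤ B := by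
    calc _ ≤ r ^ i * (B / r ^ (i + 1) * r) := by gcongr; exact hmv.trans (by gcongr)
      _ = B := by rw [pow_succ]; field_simp
  have htri := norm_le_norm_sub_add (iteratedFDerivWithin ℝ i u (closedBall 0 r) x)
    (iteratedFDerivWithin ℝ i u (closedBall 0 r) 0)
  have := mul_le_mul_of_nonneg_left htri (by positivity : 0 ≤ r ^ i)
  linarith

/-- The derivatives of a function at the centre of a ball form symmetric coefficients. -/
theorem iteratedFDerivWithin_mem_symmetricCoeffs {s : Set E} (hs : UniqueDiffOn ℝ s)
    {x : E} (hx : s ∈ 𝓝 x) {u : E → F} (hu : ContDiffOn ℝ 3 u s) :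
    (fun i : Fin 4 ↦ iteratedFDerivWithin ℝ i u s x) ∈ symmetricCoeffs E F := by
  intro i v σ
  have hc : ContDiffAt ℝ (i : ℕ) u x :=
    (hu.contDiffAt hx).of_le (by exact_mod_cast Nat.lt_succ_iff.1 i.2)
  simp only [iteratedFDerivWithin_eq_iteratedFDeriv hs hc (mem_of_mem_nhds hx)]
  exact hc.iteratedFDeriv_comp_perm_of_natCast v σ

variable [FiniteDimensional ℝ E] [FiniteDimensional ℝ F]
  [MeasurableSpace E] [BorelSpace E] (μ : Measure E) [μ.IsAddHaarMeasure]

variable (E F) in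
/-- Interpolation of the derivatives of order at most three between the `L¹` norm and the
oscillation of the third derivative. -/
theorem exists_norm_iteratedFDerivWithin_le : ∃ C : ℝ, 0 < C ∧ ∀ r > 0, ∀ j ≤ 3, ∀ M : ℝ,
    ∀ u : E → F, ContDiffOn ℝ 3 u (closedBall 0 r) →
    (∀ x ∈ closedBall (0 : E) r, ‖iteratedFDerivWithin ℝ 3 u (closedBall 0 r) x -
      iteratedFDerivWithin ℝ 3 u (closedBall 0 r) 0‖ ≤ M) →
    ∀ x ∈ closedBall (0 : E) r, r ^ j * ‖iteratedFDerivWithin ℝ j u (closedBall 0 r) x‖ ≤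
      C * ((r ^ Module.finrank ℝ E)⁻¹ * (∫ y in ball (0 : E) r, ‖u y‖ ∂μ) + M * r ^ 3) := by
  obtain ⟨C, hC, hcoeff⟩ := exists_norm_coeff_le_integral_norm_cubicPoly (E := E) (F := F) μ
  set V := μ.real (ball (0 : E) 1) with hV
  have hV0 : 0 ≤ V := measureReal_nonneg
  refine ⟨4 * C * (1 + V) + 1, by positivity, fun r hr j hj M u hu hM ↦ ?_⟩
  set s := closedBall (0 : E) r
  set d := Module.finrank ℝ E
  have hconv : Convex ℝ s := convex_closedBall 0 r
  have huniq : UniqueDiffOn ℝ s :=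
    uniqueDiffOn_convex hconv ⟨0, ball_subset_interior_closedBall (mem_ball_self hr)⟩
  have h0 : (0 : E) ∈ s := mem_closedBall_self hr.le
  have hM0 : 0 ≤ M := (norm_nonneg _).trans (hM 0 h0)
  set c : ∀ i : Fin 4, E [×i]→L[ℝ] F := fun i ↦ iteratedFDerivWithin ℝ i u s 0
  have hcsymm : c ∈ symmetricCoeffs E F :=
    iteratedFDerivWithin_mem_symmetricCoeffs huniq (closedBall_mem_nhds 0 hr) hu
  set I := ∫ y in ball (0 : E) r, ‖u y‖ ∂μ with hI
  have hI0 : 0 ≤ I := by positivity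
  have hvol : μ.real (ball (0 : E) r) = r ^ d * V := by
    rw [hV, measureReal_def, Measure.addHaar_ball_of_pos μ 0 hr, ENNReal.toReal_mul,
      ENNReal.toReal_ofReal (by positivity), measureReal_def]
  have hpoly : ∫ y in ball (0 : E) r, ‖cubicPoly c y‖ ∂μ ≤ I + M * r ^ 3 * (r ^ d * V) := by
    have hui : IntegrableOn (fun y ↦ ‖u y‖) (ball 0 r) μ :=
      (hu.continuousOn.norm.integrableOn_compact (isCompact_closedBall 0 r)).mono_set
        ball_subset_closedBall
    have hpi : IntegrableOn (fun y ↦ ‖cubicPoly c y‖) (ball 0 r) μ :=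
      ((continuous_cubicPoly c).norm.continuousOn.integrableOn_compact
        (isCompact_closedBall 0 r)).mono_set ball_subset_closedBall
    have hconst : IntegrableOn (fun _ : E ↦ M * r ^ 3) (ball 0 r) μ :=
      integrableOn_const measure_ball_lt_top.ne
    refine (setIntegral_mono_on hpi (hui.add hconst) measurableSet_ball fun y hy ↦ ?_).trans_eq ?_
    · have hy' := ball_subset_closedBall hy
      have hT := norm_sub_cubicPoly_le hconv huniq h0 hu hy' hM
      have hyr : ‖y‖ ≤ r := by simpa using hy'
      have hT' : M * ‖y‖ ^ 3 ≤ M * r ^ 3 := by gcongr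
      have := norm_sub_norm_le (cubicPoly c y) (u y)
      rw [norm_sub_rev] at this
      change _ ≤ ‖u y‖ + M * r ^ 3
      linarith
    · simp only [Pi.add_apply]
      rw [integral_add hui hconst, setIntegral_const, hvol, smul_eq_mul, hI]
      ring
  set N := (r ^ d)⁻¹ * I + M * r ^ 3 with hN
  have hN0 : 0 ≤ N := by positivity
  have hcoeff' : ∀ i : Fin 4, r ^ (i : ℕ) * ‖c i‖ ≤ C * (1 + V) * N := by
    intro i
    refine (hcoeff c hcsymm r hr i).trans ?_
    rw [mul_assoc]
    refine mul_le_mul_of_nonneg_left ?_ hC.le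
    calc (r ^ d)⁻¹ * ∫ y in ball (0 : E) r, ‖cubicPoly c y‖ ∂μ
        ≤ (r ^ d)⁻¹ * (I + M * r ^ 3 * (r ^ d * V)) := by gcongr
      _ = (r ^ d)⁻¹ * I + M * r ^ 3 * V := by field_simp
      _ ≤ (1 + V) * N := by
        have h1 : 0 ≤ V * ((r ^ d)⁻¹ * I) := by positivity
        have h2 : 0 ≤ M * r ^ 3 := by positivity
        rw [hN]
        nlinarith
  set A := C * (1 + V) * N with hA
  have hA0 : 0 ≤ A := by positivity
  have h3 : ∀ x ∈ s, r ^ 3 * ‖iteratedFDerivWithin ℝ 3 u s x‖ ≤ A + N := by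
    intro x hx
    have h := norm_le_norm_sub_add (iteratedFDerivWithin ℝ 3 u s x)
      (iteratedFDerivWithin ℝ 3 u s 0)
    have h' := mul_le_mul_of_nonneg_left (h.trans (add_le_add_left (hM x hx) _))
      (by positivity : 0 ≤ r ^ 3)
    have h'' : r ^ 3 * ‖iteratedFDerivWithin ℝ 3 u s 0‖ ≤ A := hcoeff' 3
    have h3 : 0 ≤ (r ^ d)⁻¹ * I := by positivity
    rw [hN]
    linarith
  have h2 := norm_iteratedFDerivWithin_le_of_succ (n := 3) hr hu (by norm_num) (hcoeff' 2) h3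
  have h1 := norm_iteratedFDerivWithin_le_of_succ (n := 3) hr hu (by norm_num) (hcoeff' 1) h2
  have h0 := norm_iteratedFDerivWithin_le_of_succ (n := 3) hr hu (by norm_num) (hcoeff' 0) h1
  have hfinal : (4 * C * (1 + V) + 1) * N = A + (A + (A + (A + N))) := by rw [hA]; ring
  intro x hx
  rw [hfinal]
  interval_cases j
  · exact h0 x hx
  · exact (h1 x hx).trans (by linarith)
  · exact (h2 x hx).trans (by linarith)
  · exact (h3 x hx).trans (by linarith)

end Interpolation

/-- interior interpolation estimate, third-order version.  There is `C > 0`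
depending only on `m, k, κ` such that for every `r > 0`, every `j ∈ {0,1,2,3}`, every
`K ≥ 0`, and every `u : ℝ^m → ℝ^k` of class `C³` on `closedBall 0 r` whose third
derivative (taken within the closed ball) is `κ`-Hölder with constant `K` there, one has
`sup_{x ∈ closedBall 0 r} ‖D^j u(x)‖ ≤ C r^{-m-j} ∫_{B_r(0)} ‖u‖ + C r^{3+κ-j} K`. -/
theorem statement10 (m k : ℕ) (hm : 0 < m) (hk : 0 < k)
    (κ : ℝ) (hκ : κ ∈ Set.Ioc (0 : ℝ) 1) :
    ∃ C : ℝ, 0 < C ∧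
      ∀ (r : ℝ), 0 < r → ∀ (j : ℕ), j ≤ 3 → ∀ (K : ℝ), 0 ≤ K →
        ∀ u : EuclideanSpace ℝ (Fin m) → EuclideanSpace ℝ (Fin k),
          ContDiffOn ℝ 3 u (Metric.closedBall 0 r) →
          (∀ x ∈ Metric.closedBall (0 : EuclideanSpace ℝ (Fin m)) r,
            ∀ y ∈ Metric.closedBall (0 : EuclideanSpace ℝ (Fin m)) r,
              ‖iteratedFDerivWithin ℝ 3 u (Metric.closedBall 0 r) x -
                iteratedFDerivWithin ℝ 3 u (Metric.closedBall 0 r) y‖ ≤ K * ‖x - y‖ ^ κ) →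
          ∀ x ∈ Metric.closedBall (0 : EuclideanSpace ℝ (Fin m)) r,
            ‖iteratedFDerivWithin ℝ j u (Metric.closedBall 0 r) x‖ ≤
              C * r ^ (-(m : ℝ) - (j : ℝ)) *
                  (∫ y in Metric.ball (0 : EuclideanSpace ℝ (Fin m)) r, ‖u y‖) +
                C * r ^ (3 + κ - (j : ℝ)) * K := by
  obtain ⟨C, hC, h⟩ := exists_norm_iteratedFDerivWithin_le (EuclideanSpace ℝ (Fin m))
    (EuclideanSpace ℝ (Fin k)) volume
  refine ⟨C, hC, fun r hr j hj K hK u hu hD x hx ↦ ?_⟩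
  have h := h r hr j hj (K * r ^ κ) u hu (fun y hy ↦ ?_) x hx
  · rw [finrank_euclideanSpace_fin] at h
    rw [← le_div_iff₀' (by positivity)] at h
    refine h.trans_eq ?_
    rw [Real.rpow_sub hr, Real.rpow_neg hr.le, Real.rpow_sub hr, Real.rpow_add hr]
    simp only [Real.rpow_natCast, Real.rpow_ofNat]
    field_simp
  · refine (hD y hy 0 (mem_closedBall_self hr.le)).trans ?_
    have hyr : ‖y - 0‖ ≤ r := by simpa using hy
    have := hκ.1
    gcongr
end
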